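/- Let P = ∏_{p prime} 𝔽_p be the direct product over all prime numbers p of the prime fields 𝔽_p = ZMod p, equipped with the pointwise inverse operation inv, and let A be the smallest subring of P that is closed under inv; note that A itself is a meadow under the restriction of the operations of P. Then A is an initial object in the category of meadows: for every meadow M (a commutative ring with identity with a unary operation inv_M satisfying inv_M (inv_M x) = x and x * (x * inv_M x) = x for all x), there exists exactly one ring homomorphism h : A → M satisfying h (inv a) = inv_M (h a) for all a ∈ A. -/

import Mathlib

/-- The index type of all prime numbers. -/
abbrev Primes : Type := {p : ℕ // Nat.Prime p}

/-- `P` is the direct product over all primes `p` of the prime fields `ZMod p`. -/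
abbrev P : Type := ∀ p : Primes, ZMod p.1

/-- The pointwise (zero-totalized) inverse operation on `P`. -/
def pinv (x : P) : P := fun p => (x p)⁻¹

/-- `A` is the smallest subring of `P` that is closed under the inverse operation. -/
def A : Subring P := sInf {S : Subring P | ∀ x ∈ S, pinv x ∈ S}

/-- `A` is closed under the inverse operation. -/
lemma pinv_mem_A {x : P} (hx : x ∈ A) : pinv x ∈ A := by
  rw [A, Subring.mem_sInf] at hx ⊢
  intro S hS
  exact hS x (hx S hS)

/-- The inverse operation of `A`, i.e. the restriction of `pinv` to `A`. -/
def Ainv (a : A) : A := ⟨pinv (a : P), pinv_mem_A a.2⟩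

lemma fact_prime (p : Primes) : Fact p.1.Prime := ⟨p.2⟩

lemma pinv_pinv (x : P) : pinv (pinv x) = x :=
  funext fun p => by
    have := fact_prime p
    exact inv_inv (x p)

lemma mul_mul_pinv (x : P) : x * (x * pinv x) = x := by
  funext p
  have := fact_prime p
  change x p * (x p * (x p)⁻¹) = x p
  by_cases h : x p = 0
  · simp [h]
  · rw [mul_inv_cancel₀ h, mul_one]

/-- `A` is contained in every subring of `P` that is closed under the inverse operation. -/
lemma A_le {S : Subring P} (hS : ∀ x ∈ S, pinv x ∈ S) : A ≤ S :=
  sInf_le hS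

section Meadow

variable {M : Type*} [CommRing M] {invM : M → M}

/-- Every ring homomorphism from a meadow to a field preserves inverses. -/
lemma map_invM {K : Type*} [Field K] (hinv : ∀ x, invM (invM x) = x)
    (hmul : ∀ x, x * (x * invM x) = x) (f : M →+* K) (x : M) : f (invM x) = (f x)⁻¹ := by
  by_cases h : f x = 0
  · have h1 := congrArg f (hmul (invM x))
    rw [hinv] at h1
    simp only [map_mul, h, mul_zero] at h1
    rw [← h1, h, inv_zero]
  · have h1 := congrArg f (hmul x)
    simp only [map_mul] at h1
    exact eq_inv_of_mul_eq_one_right (mul_left_cancel₀ h (h1.trans (mul_one _).symm))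

/-- A nonzero element of a meadow stays nonzero in some field. -/
lemma exists_field_map_ne_zero.{u} {M : Type u} [CommRing M] {invM : M → M}
    (hmul : ∀ x, x * (x * invM x) = x) {m : M} (hm : m ≠ 0) :
    ∃ (K : Type u) (_ : Field K) (f : M →+* K), f m ≠ 0 := by
  have : IsReduced M := (isReduced_iff_pow_one_lt 2 one_lt_two).mpr fun x hx => by
    rw [← hmul x, ← mul_assoc, ← sq, hx, zero_mul]
  have hn : ¬ IsNilpotent m := fun h => hm h.eq_zero
  rw [nilpotent_iff_mem_prime] at hn
  push Not at hn
  obtain ⟨I, hI, hmI⟩ := hn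
  refine ⟨FractionRing (M ⧸ I), inferInstance,
    (algebraMap (M ⧸ I) _).comp (Ideal.Quotient.mk I), fun h => hmI ?_⟩
  rw [RingHom.comp_apply, FaithfulSMul.algebraMap_eq_zero_iff] at h
  exact Ideal.Quotient.eq_zero_iff_mem.mp h

variable (invM) in
/-- The smallest subring of `P × M` that is closed under the componentwise inverse operation. -/
def graphSubring : Subring (P × M) :=
  sInf {S | ∀ z ∈ S, (pinv z.1, invM z.2) ∈ S}

lemma graphSubring_le {S : Subring (P × M)} (hS : ∀ z ∈ S, (pinv z.1, invM z.2) ∈ S) :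
    graphSubring invM ≤ S :=
  sInf_le hS

lemma inv_mem_graphSubring {z : P × M} (hz : z ∈ graphSubring invM) :
    (pinv z.1, invM z.2) ∈ graphSubring invM := by
  rw [graphSubring, Subring.mem_sInf] at hz ⊢
  exact fun S hS => hS z (hz S hS)

lemma map_snd_of_charP {K : Type*} [Field K] (hinv : ∀ x, invM (invM x) = x)
    (hmul : ∀ x, x * (x * invM x) = x) (f : M →+* K) (p : Primes) [CharP K p.1]
    {z : P × M} (hz : z ∈ graphSubring invM) :
    f z.2 = ZMod.castHom (dvd_refl p.1) K (z.1 p) := by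
  let S : Subring (P × M) := RingHom.eqLocus (f.comp (RingHom.snd P M))
    ((ZMod.castHom (dvd_refl p.1) K).comp ((Pi.evalRingHom _ p).comp (RingHom.fst P M)))
  refine graphSubring_le (S := S) (fun w hw => ?_) hz
  change f w.2 = ZMod.castHom (dvd_refl p.1) K (w.1 p) at hw
  change f (invM w.2) = ZMod.castHom (dvd_refl p.1) K (w.1 p)⁻¹
  have := fact_prime p
  rw [map_invM hinv hmul, hw, map_inv₀]

lemma eventually_intCast_ne_zero {b : ℤ} (hb : b ≠ 0) :
    ∀ᶠ p : Primes in Filter.cofinite, (b : ZMod p.1) ≠ 0 := by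
  have hfin : {p : Primes | p.1 ≤ b.natAbs}.Finite :=
    (Set.finite_Iic b.natAbs).preimage Subtype.val_injective.injOn
  refine hfin.subset fun p hp => ?_
  simp only [Set.mem_compl_iff, Set.mem_ofPred_eq, not_not] at hp
  rw [ZMod.intCast_zmod_eq_zero_iff_dvd] at hp
  exact Nat.le_of_dvd (Int.natAbs_pos.mpr hb) (Int.natCast_dvd.mp hp)

/-- The pairs whose second component is mapped to a rational number `a / b`, with almost all
coordinates of the first component equal to the reduction of the same number. -/
def rationalSubring {K : Type*} [Field K] (f : M →+* K) : Subring (P × M) where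
  carrier := {z | ∃ a b : ℤ, b ≠ 0 ∧ b * f z.2 = a ∧
    ∀ᶠ p : Primes in Filter.cofinite, (b : ZMod p.1) * z.1 p = a}
  zero_mem' := ⟨0, 1, one_ne_zero, by simp, by simp⟩
  one_mem' := ⟨1, 1, one_ne_zero, by simp, by simp⟩
  neg_mem' := by
    rintro z ⟨a, b, hb, h, hp⟩
    refine ⟨-a, b, hb, by simp [h], hp.mono fun p h => by simp [h]⟩
  add_mem' := by
    rintro z w ⟨a, b, hb, h, hp⟩ ⟨c, d, hd, k, hq⟩
    refine ⟨a * d + c * b, b * d, mul_ne_zero hb hd, ?_, ?_⟩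
    · push_cast [Prod.snd_add, map_add]
      linear_combination (d : K) * h + (b : K) * k
    · filter_upwards [hp, hq] with p h k
      push_cast [Prod.fst_add, Pi.add_apply]
      linear_combination (d : ZMod p.1) * h + (b : ZMod p.1) * k
  mul_mem' := by
    rintro z w ⟨a, b, hb, h, hp⟩ ⟨c, d, hd, k, hq⟩
    refine ⟨a * c, b * d, mul_ne_zero hb hd, ?_, ?_⟩
    · push_cast [Prod.snd_mul, map_mul]
      rw [← h, ← k]
      ring
    · filter_upwards [hp, hq] with p h k
      push_cast [Prod.fst_mul, Pi.mul_apply]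
      rw [← h, ← k]
      ring

lemma mul_inv_eq_of_mul_eq {K : Type*} [Field K] {a b x : K} (ha : a ≠ 0) (h : b * x = a) :
    a * x⁻¹ = b := by
  have hx : x ≠ 0 := right_ne_zero_of_mul (h ▸ ha)
  rw [← h, mul_inv_cancel_right₀ hx]

lemma graphSubring_le_rationalSubring {K : Type*} [Field K] [CharZero K]
    (hinv : ∀ x, invM (invM x) = x) (hmul : ∀ x, x * (x * invM x) = x) (f : M →+* K) :
    graphSubring invM ≤ rationalSubring f := by
  refine graphSubring_le ?_
  rintro z ⟨a, b, hb, h, hp⟩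
  by_cases ha : a = 0
  · refine ⟨0, 1, one_ne_zero, ?_, ?_⟩
    · have : f z.2 = 0 := by simpa [ha, hb] using h
      simp [map_invM hinv hmul, this]
    · filter_upwards [hp, eventually_intCast_ne_zero hb] with p h hbp
      have := fact_prime p
      have : z.1 p = 0 := by simpa [ha, hbp] using h
      simp [pinv, this]
  · refine ⟨b, a, ha, ?_, ?_⟩
    · rw [map_invM hinv hmul]
      exact mul_inv_eq_of_mul_eq (Int.cast_ne_zero.mpr ha) h
    · filter_upwards [hp, eventually_intCast_ne_zero ha] with p h hap
      have := fact_prime p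
      exact mul_inv_eq_of_mul_eq hap h

instance : Infinite Primes := Nat.infinite_setOfPred_prime.to_subtype

lemma snd_eq_zero_of_mem_graphSubring (hinv : ∀ x, invM (invM x) = x)
    (hmul : ∀ x, x * (x * invM x) = x) {z : P × M} (hz : z ∈ graphSubring invM)
    (h0 : z.1 = 0) : z.2 = 0 := by
  by_contra hm
  obtain ⟨K, _, f, hf⟩ := exists_field_map_ne_zero hmul hm
  apply hf
  obtain ⟨q, hq⟩ := CharP.exists K
  rcases CharP.char_is_prime_or_zero K q with hprime | rfl
  · have : CharP K (⟨q, hprime⟩ : Primes).1 := hq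
    rw [map_snd_of_charP hinv hmul f ⟨q, hprime⟩ hz, h0, Pi.zero_apply, map_zero]
  · have := CharP.charP_to_charZero K
    obtain ⟨a, b, hb, h, hp⟩ := graphSubring_le_rationalSubring hinv hmul f hz
    have ha : a = 0 := by
      by_contra ha
      obtain ⟨p, hp, hap⟩ := (hp.and (eventually_intCast_ne_zero ha)).exists
      exact hap (by simpa [h0] using hp.symm)
    simpa [ha, hb] using h

variable (invM) in
/-- The first projection from `graphSubring invM` to `A`. -/
def graphFst : graphSubring invM →+* A :=
  ((RingHom.fst P M).comp (graphSubring invM).subtype).codRestrict A fun z =>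
    graphSubring_le (S := A.comap (RingHom.fst P M)) (fun _ hw => pinv_mem_A hw) z.2

lemma graphFst_bijective (hinv : ∀ x, invM (invM x) = x)
    (hmul : ∀ x, x * (x * invM x) = x) : Function.Bijective (graphFst invM) := by
  constructor
  · rw [injective_iff_map_eq_zero]
    intro z hz
    have h0 : z.1.1 = 0 := congrArg Subtype.val hz
    exact Subtype.ext (Prod.ext h0 (snd_eq_zero_of_mem_graphSubring hinv hmul z.2 h0))
  · intro a
    have hA : A ≤ (graphSubring invM).map (RingHom.fst P M) := A_le <| by
      rintro _ ⟨z, hz, rfl⟩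
      exact ⟨_, inv_mem_graphSubring hz, rfl⟩
    obtain ⟨z, hz, hza⟩ := hA a.2
    exact ⟨⟨z, hz⟩, Subtype.ext hza⟩

lemma exists_hom (hinv : ∀ x, invM (invM x) = x) (hmul : ∀ x, x * (x * invM x) = x) :
    ∃ h : A →+* M, ∀ a : A, h (Ainv a) = invM (h a) := by
  let e := RingEquiv.ofBijective (graphFst invM) (graphFst_bijective hinv hmul)
  refine ⟨((RingHom.snd P M).comp (graphSubring invM).subtype).comp e.symm.toRingHom,
    fun a => ?_⟩
  obtain ⟨z, rfl⟩ := e.surjective a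
  have hz : Ainv (e z) = e ⟨_, inv_mem_graphSubring z.2⟩ := rfl
  rw [hz]
  simp

lemma hom_unique {h k : A →+* M} (hh : ∀ a : A, h (Ainv a) = invM (h a))
    (hk : ∀ a : A, k (Ainv a) = invM (k a)) : h = k := by
  have hA : A ≤ (h.eqLocus k).map A.subtype := A_le <| by
    rintro _ ⟨a, ha, rfl⟩
    refine ⟨Ainv a, ?_, rfl⟩
    change h a = k a at ha
    change h (Ainv a) = k (Ainv a)
    rw [hh, hk, ha]
  ext a
  obtain ⟨b, hb, hba⟩ := hA a.2
  obtain rfl : b = a := Subtype.ext hba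
  exact hb

end Meadow

/-- `A` (with the restricted operations) is a meadow, and it is an
initial object in the category of meadows: for every meadow `M` there is exactly
one ring homomorphism `A → M` commuting with the inverse operations. -/
theorem A_initial_meadow :
    (∀ a : A, Ainv (Ainv a) = a) ∧
    (∀ a : A, a * (a * Ainv a) = a) ∧
    (∀ (M : Type*) [CommRing M] (invM : M → M),
      (∀ x : M, invM (invM x) = x) →
      (∀ x : M, x * (x * invM x) = x) →
      ∃! h : A →+* M, ∀ a : A, h (Ainv a) = invM (h a)) := by
  refine ⟨fun a => Subtype.ext (pinv_pinv a.1), fun a => Subtype.ext (mul_mul_pinv a.1), ?_⟩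
  intro M _ invM hinv hmul
  obtain ⟨h, hh⟩ := exists_hom hinv hmul
  exact ⟨h, hh, fun k hk => hom_unique hk hh⟩
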